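/- arXiv:2012.09238 — 5 statements merged into one kernel-verified Lean document; each statement's English description precedes it below -/
import Mathlib

section
/- Let A be a unital C*-algebra over ℂ and let (a i), i ∈ Fin n, satisfy the CAR. Let Q : Matrix (Fin n) (Fin n) ℂ be Hermitian (Qᴴ = Q) with trace zero, and let H_Q := Σ_{i,j} Q i j • (a i)* * (a j). Then ‖H_Q‖ ≤ (1/2)·‖Q‖₁, where ‖Q‖₁ denotes the trace norm of Q (the sum of the absolute values of the eigenvalues of Q). -/
/-- If `b` squares to zero and `b * star b + star b * b = 1`, then `star b * b` is within
distance `1 / 2` of the scalar `1 / 2`. -/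
theorem norm_star_mul_self_sub_half_le
    {A : Type*} [NormedRing A] [StarRing A] [CStarRing A] [NormedAlgebra ℂ A]
    (b : A) (hb : b * b = 0) (hb' : b * star b + star b * b = 1) :
    ‖star b * b - (1 / 2 : ℂ) • (1 : A)‖ ≤ 1 / 2 := by
  have hbs : b * star b = 1 - star b * b := eq_sub_of_add_eq hb'
  have hproj : star b * b * (star b * b) = star b * b := by
    calc star b * b * (star b * b) = star b * (b * star b) * b := by noncomm_ring
      _ = star b * b - star b * star b * (b * b) := by rw [hbs]; noncomm_ring
      _ = star b * b := by rw [hb]; simp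
  have hone : ‖(1 : A)‖ ≤ 1 := by
    have h := CStarRing.norm_star_mul_self (x := (1 : A))
    rw [star_one, one_mul] at h
    nlinarith [norm_nonneg (1 : A)]
  set u : A := star b * b + star b * b - 1 with hu
  have hsq : star u * u = 1 := by
    have hsa : star u = u := by simp [hu]
    rw [hsa, hu]
    calc _ = 4 • (star b * b * (star b * b)) - 4 • (star b * b) + 1 := by noncomm_ring
      _ = 1 := by rw [hproj]; simp
  have hnorm : ‖u‖ ≤ 1 := by
    have h := CStarRing.norm_star_mul_self (x := u)
    rw [hsq] at h
    nlinarith [norm_nonneg u]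
  have heq : star b * b - (1 / 2 : ℂ) • (1 : A) = (1 / 2 : ℂ) • u := by
    rw [hu]
    module
  rw [heq, norm_smul]
  norm_num
  linarith

/-- A linear combination of elements anticommuting with one another (and with themselves)
squares to zero. -/
theorem sum_smul_mul_self_eq_zero_of_anticomm
    {A ι : Type*} [Ring A] [Algebra ℂ A] [Fintype ι] (a : ι → A)
    (ha : ∀ i j, a i * a j + a j * a i = 0) (c : ι → ℂ) :
    (∑ i, c i • a i) * (∑ i, c i • a i) = 0 := by
  have h : (∑ i, c i • a i) * (∑ i, c i • a i) = ∑ i, ∑ j, (c i * c j) • (a i * a j) := by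
    simp only [Finset.sum_mul_sum, smul_mul_smul_comm]
  have h2 : (2 : ℂ) • ((∑ i, c i • a i) * (∑ i, c i • a i)) = 0 := by
    rw [two_smul]
    nth_rewrite 2 [h.trans Finset.sum_comm]
    rw [h, ← Finset.sum_add_distrib]
    refine Finset.sum_eq_zero fun i _ => ?_
    rw [← Finset.sum_add_distrib]
    refine Finset.sum_eq_zero fun j _ => ?_
    rw [mul_comm (c j), ← smul_add, ha, smul_zero]
  exact (smul_eq_zero.mp h2).resolve_left two_ne_zero

/-- A linear combination of a CAR family with coefficients of unit length again satisfies the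
mixed anticommutation relation. -/
theorem sum_smul_mul_star_add_star_mul_self
    {A ι : Type*} [Ring A] [StarRing A] [Algebra ℂ A] [StarModule ℂ A] [Fintype ι]
    [DecidableEq ι] (a : ι → A)
    (ha : ∀ i j, a i * star (a j) + star (a j) * a i = if i = j then 1 else 0)
    (c : ι → ℂ) (hc : ∑ i, c i * star (c i) = 1) :
    (∑ i, c i • a i) * star (∑ i, c i • a i) + star (∑ i, c i • a i) * (∑ i, c i • a i) = 1 := by
  simp only [star_sum, star_smul, Finset.sum_mul_sum, smul_mul_smul_comm]
  rw [Finset.sum_comm (f := fun i j => (star (c i) * c j) • (star (a i) * a j)),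
    ← Finset.sum_add_distrib]
  simp only [← Finset.sum_add_distrib, mul_comm (star (c _)), ← smul_add, ha]
  simp only [smul_ite, smul_zero, Finset.sum_ite_eq, Finset.mem_univ, if_true]
  rw [← Finset.sum_smul, hc, one_smul]

/-- The norm of a free-fermionic element `H_Q` built from a CAR family, for a
Hermitian traceless matrix `Q`, is at most half the trace norm of `Q` (the sum
of the absolute values of the eigenvalues of `Q`). -/
theorem car_free_fermionic_norm_le
    {A : Type*} [NormedRing A] [StarRing A] [CStarRing A]
    [NormedAlgebra ℂ A] [CompleteSpace A] [StarModule ℂ A]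
    {n : ℕ} (a : Fin n → A)
    (hcar1 : ∀ i j, a i * a j + a j * a i = 0)
    (hcar2 : ∀ i j, a i * star (a j) + star (a j) * a i =
      if i = j then 1 else 0)
    (Q : Matrix (Fin n) (Fin n) ℂ) (hQ : Q.IsHermitian) (htr : Q.trace = 0) :
    ‖∑ i, ∑ j, Q i j • (star (a i) * a j)‖ ≤ (1 / 2) * ∑ k, |hQ.eigenvalues k| := by
  set U : Matrix (Fin n) (Fin n) ℂ := (hQ.eigenvectorUnitary : Matrix (Fin n) (Fin n) ℂ) with hU
  have hentry : ∀ i j, Q i j = ∑ k, U i k * (hQ.eigenvalues k : ℂ) * star (U j k) := by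
    intro i j
    conv_lhs => rw [hQ.spectral_theorem]
    simp [Unitary.conjStarAlgAut_apply, Matrix.mul_apply, Matrix.diagonal_apply, hU]
  have hunit : ∀ k, ∑ j, star (U j k) * star (star (U j k)) = 1 := by
    intro k
    have h : star U * U = 1 := Unitary.coe_star_mul_self hQ.eigenvectorUnitary
    have h' := congrFun (congrFun h k) k
    simpa [Matrix.mul_apply] using h'
  have hsum : ∑ k, (hQ.eigenvalues k : ℂ) = 0 := by
    rw [← htr, hQ.trace_eq_sum_eigenvalues]
    rfl
  set b : Fin n → A := fun k => ∑ j, star (U j k) • a j with hb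
  have hdiag : ∑ i, ∑ j, Q i j • (star (a i) * a j) =
      ∑ k, (hQ.eigenvalues k : ℂ) • (star (b k) * b k - (1 / 2 : ℂ) • (1 : A)) := by
    have hright : ∑ k, (hQ.eigenvalues k : ℂ) • (star (b k) * b k - (1 / 2 : ℂ) • (1 : A)) =
        ∑ k, (hQ.eigenvalues k : ℂ) • (star (b k) * b k) := by
      simp only [smul_sub]
      rw [Finset.sum_sub_distrib, ← Finset.sum_smul, hsum, zero_smul, sub_zero]
    rw [hright]
    simp only [hb, star_sum, star_smul, star_star, Finset.sum_mul_sum, smul_mul_smul_comm,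
      hentry, Finset.sum_smul, Finset.smul_sum, smul_smul]
    rw [Finset.sum_comm_cycle]
    refine Finset.sum_congr rfl fun k _ => Finset.sum_congr rfl fun i _ =>
      Finset.sum_congr rfl fun j _ => ?_
    congr 1
    ring
  rw [hdiag, Finset.mul_sum]
  refine (norm_sum_le _ _).trans (Finset.sum_le_sum fun k _ => ?_)
  have hk := norm_star_mul_self_sub_half_le (b k)
    (sum_smul_mul_self_eq_zero_of_anticomm a hcar1 _)
    (sum_smul_mul_star_add_star_mul_self a hcar2 _ (hunit k))
  rw [norm_smul, Complex.norm_real, Real.norm_eq_abs, mul_comm]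
  exact mul_le_mul_of_nonneg_right hk (abs_nonneg _)
end

section
/- Let A be a unital C*-algebra over ℂ and let (a (i, σ)) be a family indexed by S × Bool satisfying the CAR, with z (i,σ) := 2 • (a (i,σ))* * a (i,σ) − 1. Then for any two distinct sites i ≠ j and any spin σ, the element z (i,↑) * z (i,↓) anticommutes with the hopping term (a (i,σ))* * a (j,σ): z (i,↑)*z (i,↓) * (a (i,σ))* * a (j,σ) + (a (i,σ))* * a (j,σ) * z (i,↑)*z (i,↓) = 0. Moreover, for any site k with k ≠ i and k ≠ j, z (k,↑)*z (k,↓) commutes with (a (i,σ))* * a (j,σ). -/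
/-- If `c` anticommutes with `b` and `s`, then it commutes with `2 s b - 1`. -/
theorem commute_two_nsmul_mul_sub_one {R : Type*} [Ring R] {b s c : R}
    (hb : b * c + c * b = 0) (hs : s * c + c * s = 0) :
    Commute (2 • (s * b) - 1) c := by
  have h : Commute (s * b) c := by
    rw [Commute, SemiconjBy, mul_assoc, eq_neg_of_add_eq_zero_left hb, mul_neg, ← mul_assoc,
      eq_neg_of_add_eq_zero_left hs, neg_mul, neg_neg, mul_assoc]
  exact (h.smul_left 2).sub_left (Commute.one_left c)

/-- If `s` squares to zero and `b s + s b = 1`, then `2 s b - 1` anticommutes with `s`. -/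
theorem two_nsmul_mul_sub_one_anticommute {R : Type*} [Ring R] {b s : R}
    (hs : s * s = 0) (hbs : b * s + s * b = 1) :
    (2 • (s * b) - 1) * s + s * (2 • (s * b) - 1) = 0 := by
  have h1 : s * b * s = s := by
    rw [mul_assoc, eq_sub_of_add_eq hbs, mul_sub, mul_one, ← mul_assoc, hs, zero_mul, sub_zero]
  have h2 : s * (s * b) = 0 := by rw [← mul_assoc, hs, zero_mul]
  rw [sub_mul, mul_sub, smul_mul_assoc, mul_smul_comm, h1, h2, one_mul, mul_one, two_nsmul,
    smul_zero]
  abel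


/-- In a Hubbard system (CAR family indexed by sites × spins), for distinct
sites `i ≠ j` and any spin `σ`, the operator `z(i,↑) z(i,↓)` anticommutes with
the hopping term `(a(i,σ))* a(j,σ)`, while `z(k,↑) z(k,↓)` commutes with it
for any site `k` distinct from both `i` and `j`. -/
theorem hubbard_zz_hopping_commutation
    {A : Type*} [NormedRing A] [StarRing A] [CStarRing A]
    [NormedAlgebra ℂ A] [CompleteSpace A] [StarModule ℂ A]
    {S : Type*} [Fintype S] [DecidableEq S]
    (a : S × Bool → A)
    (hcar1 : ∀ i j, a i * a j + a j * a i = 0)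
    (hcar2 : ∀ i j, a i * star (a j) + star (a j) * a i =
      if i = j then 1 else 0)
    (z : S → Bool → A)
    (hz : ∀ i σ, z i σ = 2 • (star (a (i, σ)) * a (i, σ)) - 1) :
    ∀ (i j : S) (σ : Bool), i ≠ j →
      ((z i true * z i false) * (star (a (i, σ)) * a (j, σ))
        + (star (a (i, σ)) * a (j, σ)) * (z i true * z i false) = 0) ∧
      (∀ k : S, k ≠ i → k ≠ j →
        (z k true * z k false) * (star (a (i, σ)) * a (j, σ))
          = (star (a (i, σ)) * a (j, σ)) * (z k true * z k false)) := by
  have hstar : ∀ p q, star (a p) * star (a q) + star (a q) * star (a p) = 0 := fun p q => by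
    simpa using congrArg star (hcar1 q p)
  have hsq : ∀ p, star (a p) * star (a p) = 0 := fun p => by
    have h := hstar p p
    rw [← two_smul ℂ] at h
    exact (smul_eq_zero.mp h).resolve_left two_ne_zero
  have hcomm : ∀ (k : S) (τ : Bool) (p : S × Bool), p ≠ (k, τ) → Commute (z k τ) (a p) := by
    intro k τ p hp
    rw [hz]
    refine commute_two_nsmul_mul_sub_one (hcar1 _ _) ?_
    rw [add_comm, hcar2, if_neg hp]
  have hcomm_star : ∀ (k : S) (τ : Bool) (p : S × Bool), p ≠ (k, τ) →
      Commute (z k τ) (star (a p)) := by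
    intro k τ p hp
    rw [hz]
    refine commute_two_nsmul_mul_sub_one ?_ (hstar _ _)
    rw [hcar2, if_neg hp.symm]
  have hanti : ∀ (k : S) (τ : Bool), z k τ * star (a (k, τ)) = -(star (a (k, τ)) * z k τ) := by
    intro k τ
    rw [hz]
    exact eq_neg_of_add_eq_zero_left
      (two_nsmul_mul_sub_one_anticommute (hsq _) (by rw [hcar2, if_pos rfl]))
  intro i j σ hij
  refine ⟨?_, fun k hki hkj => ?_⟩
  · have hj : ∀ τ, Commute (z i τ) (a (j, σ)) := fun τ => hcomm i τ _ (by simp [hij.symm])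
    have hi : z i true * z i false * star (a (i, σ)) =
        -(star (a (i, σ)) * (z i true * z i false)) := by
      cases σ with
      | true =>
        rw [mul_assoc, (hcomm_star i false (i, true) (by simp)).eq, ← mul_assoc, hanti,
          neg_mul, mul_assoc]
      | false =>
        rw [mul_assoc, hanti, mul_neg, ← mul_assoc,
          (hcomm_star i true (i, false) (by simp)).eq, mul_assoc]
    rw [← mul_assoc, hi, neg_mul, mul_assoc, ((hj true).mul_left (hj false)).eq, ← mul_assoc,
      neg_add_cancel]
  · have hk : ∀ τ, Commute (z k τ) (star (a (i, σ)) * a (j, σ)) := fun τ =>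
      (hcomm_star k τ _ (by simp [hki.symm])).mul_right (hcomm k τ _ (by simp [hkj.symm]))
    exact ((hk true).mul_left (hk false)).eq
end

section
/- (First Lemma.) Let A be a unital C*-algebra over ℂ and let (a (i, σ)) be a family indexed by S × Bool (S a finite type) satisfying the CAR. Let u, and let R : Matrix S S ℂ be Hermitian with R i i = 0 for all i. Define z (i,σ) := 2 • (a (i,σ))* * a (i,σ) − 1, the interaction Hamiltonian H_I := (u/4) • Σ_{i ∈ S} z (i,↑) * z (i,↓), and the hopping Hamiltonian H_h := Σ_{i ≠ j} Σ_{σ} (R i j) • (a (i,σ))* * a (j,σ). Then for any real u, ‖[[H_I, H_h], H_I]‖ ≤ u² · ‖H_h‖. -/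
/-- The canonical anticommutation relations for a family indexed by `ι`. -/
structure IsCAR {ι A : Type*} [DecidableEq ι] [Ring A] [StarRing A] (a : ι → A) : Prop where
  anticomm : ∀ i j, a i * a j + a j * a i = 0
  anticomm_star : ∀ i j, a i * star (a j) + star (a j) * a i = if i = j then 1 else 0

namespace IsCAR

section NumberOperators

variable {ι A : Type*} [DecidableEq ι] [Ring A] [StarRing A] {a : ι → A}

/-- The number operator of the mode `p`. -/
def num (a : ι → A) (p : ι) : A := star (a p) * a p

/-- The reflection `2n - 1` of the mode `p`. -/
def modeRefl (a : ι → A) (p : ι) : A := 2 • num a p - 1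

omit [DecidableEq ι] in
lemma star_num (p : ι) : star (num a p) = num a p := by
  simp [num]

lemma commute_num (h : IsCAR a) {p q : ι} (hpq : p ≠ q) : Commute (num a p) (a q) := by
  have h1 : a p * a q = -(a q * a p) := eq_neg_of_add_eq_zero_left (h.anticomm p q)
  have h2 : star (a p) * a q = -(a q * star (a p)) := by
    have := h.anticomm_star q p
    rw [if_neg hpq.symm] at this
    exact eq_neg_of_add_eq_zero_right this
  simp only [Commute, SemiconjBy, num]
  rw [mul_assoc, h1, mul_neg, ← mul_assoc, h2, neg_mul, neg_neg, mul_assoc]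

lemma commute_num_star (h : IsCAR a) {p q : ι} (hpq : p ≠ q) :
    Commute (num a p) (star (a q)) := by
  simpa [star_num] using (h.commute_num hpq).star_star

lemma commute_num_num (h : IsCAR a) (p q : ι) : Commute (num a p) (num a q) := by
  by_cases hpq : p = q
  · rw [hpq]
  · exact (h.commute_num_star hpq).mul_right (h.commute_num hpq)

lemma commute_modeRefl (h : IsCAR a) {p q : ι} (hpq : p ≠ q) : Commute (modeRefl a p) (a q) :=
  ((h.commute_num hpq).smul_left 2).sub_left (Commute.one_left _)

lemma commute_modeRefl_star (h : IsCAR a) {p q : ι} (hpq : p ≠ q) :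
    Commute (modeRefl a p) (star (a q)) :=
  ((h.commute_num_star hpq).smul_left 2).sub_left (Commute.one_left _)

lemma commute_modeRefl_modeRefl (h : IsCAR a) (p q : ι) :
    Commute (modeRefl a p) (modeRefl a q) := by
  have h1 : Commute (modeRefl a p) (num a q) :=
    ((h.commute_num_num p q).smul_left 2).sub_left (Commute.one_left _)
  exact (h1.smul_right 2).sub_right (Commute.one_right _)

variable [Module ℂ A]

lemma mul_self (h : IsCAR a) (p : ι) : a p * a p = 0 := by
  have h1 := h.anticomm p p
  rw [← two_smul ℂ] at h1
  exact (smul_eq_zero.1 h1).resolve_left two_ne_zero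

lemma num_mul (h : IsCAR a) (p : ι) : num a p * a p = 0 := by
  rw [num, mul_assoc, h.mul_self, mul_zero]

lemma mul_num (h : IsCAR a) (p : ι) : a p * num a p = a p := by
  have h1 := h.anticomm_star p p
  rw [if_pos rfl] at h1
  rw [num, ← mul_assoc, eq_sub_of_add_eq h1, sub_mul, one_mul, mul_assoc, h.mul_self, mul_zero,
    sub_zero]

lemma num_mul_star (h : IsCAR a) (p : ι) : num a p * star (a p) = star (a p) := by
  simpa [star_num] using congrArg star (h.mul_num p)

lemma star_mul_num (h : IsCAR a) (p : ι) : star (a p) * num a p = 0 := by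
  simpa [star_num] using congrArg star (h.num_mul p)

lemma num_mul_num (h : IsCAR a) (p : ι) : num a p * num a p = num a p := by
  conv_lhs => rw [num, mul_assoc, ← num, h.mul_num, ← num]

lemma modeRefl_mul (h : IsCAR a) (p : ι) : modeRefl a p * a p = -a p := by
  rw [modeRefl, sub_mul, smul_mul_assoc, h.num_mul, smul_zero, one_mul, zero_sub]

lemma mul_modeRefl (h : IsCAR a) (p : ι) : a p * modeRefl a p = a p := by
  rw [modeRefl, mul_sub, mul_smul_comm, h.mul_num, mul_one]
  abel

lemma modeRefl_mul_star (h : IsCAR a) (p : ι) : modeRefl a p * star (a p) = star (a p) := by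
  rw [modeRefl, sub_mul, smul_mul_assoc, h.num_mul_star, one_mul]
  abel

lemma star_mul_modeRefl (h : IsCAR a) (p : ι) : star (a p) * modeRefl a p = -star (a p) := by
  rw [modeRefl, mul_sub, mul_smul_comm, h.star_mul_num, smul_zero, mul_one, zero_sub]

lemma modeRefl_mul_num (h : IsCAR a) (p : ι) : modeRefl a p * num a p = num a p := by
  rw [num, ← mul_assoc, h.modeRefl_mul_star]

lemma modeRefl_mul_modeRefl (h : IsCAR a) (p : ι) : modeRefl a p * modeRefl a p = 1 := by
  conv_lhs =>
    rw [modeRefl.eq_def a p, mul_sub, ← modeRefl, mul_smul_comm, h.modeRefl_mul_num, mul_one]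
  simp [modeRefl]

end NumberOperators

section Sites

variable {S A : Type*} [DecidableEq S] [Ring A] [StarRing A] {a : S × Bool → A}

/-- The product of the two reflections at the site `i`. -/
def siteRefl (a : S × Bool → A) (i : S) : A := modeRefl a (i, true) * modeRefl a (i, false)

/-- The sign that detects double occupancy of the site `i`. -/
def siteSign (a : S × Bool → A) (i : S) : A := 1 - 2 • (num a (i, true) * num a (i, false))

lemma siteRefl_eq (h : IsCAR a) (i : S) (σ : Bool) :
    siteRefl a i = modeRefl a (i, σ) * modeRefl a (i, !σ) := by
  cases σ
  · exact (h.commute_modeRefl_modeRefl _ _).eq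
  · rfl

lemma siteSign_eq (h : IsCAR a) (i : S) (σ : Bool) :
    siteSign a i = 1 - 2 • (num a (i, σ) * num a (i, !σ)) := by
  cases σ
  · rw [siteSign, (h.commute_num_num _ _).eq]; rfl
  · rfl

omit [DecidableEq S] in
lemma not_spin_ne (i : S) (σ : Bool) : (i, !σ) ≠ (i, σ) := by simp

lemma commute_siteRefl (h : IsCAR a) {i j : S} (hij : i ≠ j) (σ : Bool) :
    Commute (siteRefl a i) (a (j, σ)) :=
  (h.commute_modeRefl (by simp [hij])).mul_left (h.commute_modeRefl (by simp [hij]))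

lemma commute_siteRefl_star (h : IsCAR a) {i j : S} (hij : i ≠ j) (σ : Bool) :
    Commute (siteRefl a i) (star (a (j, σ))) :=
  (h.commute_modeRefl_star (by simp [hij])).mul_left (h.commute_modeRefl_star (by simp [hij]))

lemma commute_siteRefl_siteRefl (h : IsCAR a) (i j : S) :
    Commute (siteRefl a i) (siteRefl a j) :=
  ((h.commute_modeRefl_modeRefl _ _).mul_left (h.commute_modeRefl_modeRefl _ _)).mul_right
    ((h.commute_modeRefl_modeRefl _ _).mul_left (h.commute_modeRefl_modeRefl _ _))

lemma commute_siteSign (h : IsCAR a) {i j : S} (hij : i ≠ j) (σ : Bool) :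
    Commute (siteSign a i) (a (j, σ)) :=
  (Commute.one_left _).sub_left
    (((h.commute_num (by simp [hij])).mul_left (h.commute_num (by simp [hij]))).smul_left 2)

lemma star_siteSign (h : IsCAR a) (i : S) : star (siteSign a i) = siteSign a i := by
  rw [siteSign, star_sub, star_one, star_nsmul, star_mul, star_num, star_num,
    (h.commute_num_num (i, false) (i, true)).eq]

lemma commute_siteSign_star (h : IsCAR a) {i j : S} (hij : i ≠ j) (σ : Bool) :
    Commute (siteSign a i) (star (a (j, σ))) := by
  simpa [h.star_siteSign] using (h.commute_siteSign hij σ).star_star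

lemma commute_siteSign_modeRefl (h : IsCAR a) (i : S) (p : S × Bool) :
    Commute (siteSign a i) (modeRefl a p) := by
  have h1 : Commute (siteSign a i) (num a p) :=
    (Commute.one_left _).sub_left
      (((h.commute_num_num _ _).mul_left (h.commute_num_num _ _)).smul_left 2)
  exact (h1.smul_right 2).sub_right (Commute.one_right _)

variable [Module ℂ A]

lemma siteRefl_mul_self (h : IsCAR a) (i : S) : siteRefl a i * siteRefl a i = 1 := by
  conv_lhs =>
    rw [h.siteRefl_eq i false, (h.commute_modeRefl_modeRefl _ _).mul_mul_mul_comm,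
      h.modeRefl_mul_modeRefl, h.modeRefl_mul_modeRefl, one_mul]

lemma mul_siteRefl (h : IsCAR a) (i : S) (σ : Bool) :
    a (i, σ) * siteRefl a i = a (i, σ) * modeRefl a (i, !σ) := by
  rw [h.siteRefl_eq i σ, ← mul_assoc, h.mul_modeRefl]

lemma star_mul_siteRefl (h : IsCAR a) (i : S) (σ : Bool) :
    star (a (i, σ)) * siteRefl a i = -(star (a (i, σ)) * modeRefl a (i, !σ)) := by
  rw [h.siteRefl_eq i σ, ← mul_assoc, h.star_mul_modeRefl, neg_mul]

lemma siteRefl_mul (h : IsCAR a) (i : S) (σ : Bool) :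
    siteRefl a i * a (i, σ) = -(a (i, σ) * siteRefl a i) := by
  rw [h.mul_siteRefl, h.siteRefl_eq i σ, mul_assoc, (h.commute_modeRefl (not_spin_ne i σ)).eq,
    ← mul_assoc, h.modeRefl_mul, neg_mul]

lemma siteRefl_mul_star (h : IsCAR a) (i : S) (σ : Bool) :
    siteRefl a i * star (a (i, σ)) = -(star (a (i, σ)) * siteRefl a i) := by
  rw [h.star_mul_siteRefl, h.siteRefl_eq i σ, mul_assoc,
    (h.commute_modeRefl_star (not_spin_ne i σ)).eq, ← mul_assoc, h.modeRefl_mul_star, neg_neg]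

lemma siteSign_mul_self (h : IsCAR a) (i : S) : siteSign a i * siteSign a i = 1 := by
  have h1 : num a (i, true) * num a (i, false) * (num a (i, true) * num a (i, false)) =
      num a (i, true) * num a (i, false) := by
    rw [(h.commute_num_num _ _).mul_mul_mul_comm, h.num_mul_num, h.num_mul_num]
  simp only [siteSign, sub_mul, mul_sub, one_mul, mul_one, smul_mul_assoc, mul_smul_comm, h1]
  abel

lemma siteSign_mem_unitary (h : IsCAR a) (i : S) : siteSign a i ∈ unitary A := by
  rw [Unitary.mem_iff, h.star_siteSign, h.siteSign_mul_self]
  exact ⟨rfl, rfl⟩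

lemma siteSign_mul (h : IsCAR a) (i : S) (σ : Bool) :
    siteSign a i * a (i, σ) = -(a (i, σ) * modeRefl a (i, !σ)) * siteSign a i := by
  have hl : siteSign a i * a (i, σ) = a (i, σ) := by
    rw [h.siteSign_eq i σ, sub_mul, smul_mul_assoc, mul_assoc,
      (h.commute_num (not_spin_ne i σ)).eq, ← mul_assoc, h.num_mul]
    simp
  have hr : a (i, σ) * siteSign a i = -(a (i, σ) * modeRefl a (i, !σ)) := by
    rw [h.siteSign_eq i σ, mul_sub, mul_smul_comm, ← mul_assoc, h.mul_num, modeRefl, mul_sub,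
      mul_smul_comm]
    abel
  rw [← hr, mul_assoc, h.siteSign_mul_self, mul_one, hl]

lemma siteSign_mul_star (h : IsCAR a) (i : S) (σ : Bool) :
    siteSign a i * star (a (i, σ)) = -(star (a (i, σ)) * modeRefl a (i, !σ)) * siteSign a i := by
  have hl : siteSign a i * star (a (i, σ)) = -(star (a (i, σ)) * modeRefl a (i, !σ)) := by
    rw [h.siteSign_eq i σ, sub_mul, smul_mul_assoc, mul_assoc,
      (h.commute_num_star (not_spin_ne i σ)).eq, ← mul_assoc, h.num_mul_star, modeRefl, mul_sub,
      mul_smul_comm]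
    simp
  have hr : star (a (i, σ)) * siteSign a i = star (a (i, σ)) := by
    rw [h.siteSign_eq i σ, mul_sub, mul_smul_comm, ← mul_assoc, h.star_mul_num]
    simp
  rw [← hl, mul_assoc, hr]

/-- Conjugation by the product of the signs over `F` flips the site-dressed modes. -/
lemma exists_unitary (h : IsCAR a) (F : Finset S) : ∃ U ∈ unitary A, ∀ i σ,
    U * a (i, σ) = (if i ∈ F then -(a (i, σ) * modeRefl a (i, !σ)) else a (i, σ)) * U ∧
    U * star (a (i, σ)) =
      (if i ∈ F then -(star (a (i, σ)) * modeRefl a (i, !σ)) else star (a (i, σ))) * U := by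
  induction F using Finset.induction_on with
  | empty => exact ⟨1, one_mem _, by simp⟩
  | insert k F hk ih =>
    obtain ⟨U, hU, ih⟩ := ih
    refine ⟨siteSign a k * U, mul_mem (h.siteSign_mem_unitary k) hU, fun i σ => ?_⟩
    rw [mul_assoc, mul_assoc, (ih i σ).1, (ih i σ).2]
    by_cases hik : i = k
    · subst hik
      simp only [hk, if_false, Finset.mem_insert_self, if_true]
      rw [← mul_assoc, ← mul_assoc, ← mul_assoc, ← mul_assoc, h.siteSign_mul, h.siteSign_mul_star]
      exact ⟨rfl, rfl⟩
    · have hc := h.commute_siteSign (Ne.symm hik) σ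
      have hs := h.commute_siteSign_star (Ne.symm hik) σ
      have hz := h.commute_siteSign_modeRefl k (i, !σ)
      simp only [Finset.mem_insert, hik, false_or]
      rw [← mul_assoc, ← mul_assoc, ← mul_assoc, ← mul_assoc]
      split_ifs
      · rw [(hc.mul_right hz).neg_right.eq, (hs.mul_right hz).neg_right.eq]
        exact ⟨rfl, rfl⟩
      · rw [hc.eq, hs.eq]
        exact ⟨rfl, rfl⟩

variable [Fintype S]

omit [StarRing A] [Module ℂ A] in
lemma sum_mul_of_anticomm {Z : S → A} {i : S} {x : A} (hi : Z i * x = -(x * Z i))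
    (hk : ∀ k, k ≠ i → Commute (Z k) x) : (∑ k, Z k) * x = x * (∑ k, Z k - 2 • Z i) := by
  have h1 : Commute (∑ k ∈ Finset.univ.erase i, Z k) x :=
    Commute.sum_left _ _ _ fun k hk' => hk k (Finset.ne_of_mem_erase hk')
  rw [← Finset.add_sum_erase _ _ (Finset.mem_univ i), add_mul, hi, h1.eq, mul_sub, mul_add,
    mul_smul_comm]
  abel

lemma sum_siteRefl_mul_hop (h : IsCAR a) {i j : S} (hij : i ≠ j) (σ : Bool) :
    (∑ k, siteRefl a k) * (star (a (i, σ)) * a (j, σ)) =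
      star (a (i, σ)) * a (j, σ) *
        (∑ k, siteRefl a k - 2 • (siteRefl a i + siteRefl a j)) := by
  rw [← mul_assoc, sum_mul_of_anticomm (h.siteRefl_mul_star i σ)
    fun k hk => h.commute_siteRefl_star hk σ, mul_assoc, sub_mul,
    sum_mul_of_anticomm (h.siteRefl_mul j σ) fun k hk => h.commute_siteRefl hk σ,
    smul_mul_assoc, (h.commute_siteRefl hij σ).eq, ← mul_smul_comm, ← mul_sub, mul_assoc, smul_add]
  congr 2
  abel

lemma double_commutator_hop (h : IsCAR a) {i j : S} (hij : i ≠ j) (σ : Bool) {Q T : A}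
    (hQ : Q = ∑ k, siteRefl a k) (hT : T = star (a (i, σ)) * a (j, σ)) :
    (Q * T - T * Q) * Q - Q * (Q * T - T * Q) =
      -(8 • (T + T * (siteRefl a i * siteRefl a j))) := by
  set W := siteRefl a i + siteRefl a j with hW
  have h1 : Q * T = T * (Q - 2 • W) := by rw [hQ, hT]; exact h.sum_siteRefl_mul_hop hij σ
  have h2 : W * Q = Q * W := by
    rw [hQ]
    exact Commute.sum_right _ _ _ fun k _ =>
      (h.commute_siteRefl_siteRefl i k).add_left (h.commute_siteRefl_siteRefl j k)
  have h3 : W * W = 2 • (1 + siteRefl a i * siteRefl a j) := by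
    rw [hW, add_mul, mul_add, mul_add, h.siteRefl_mul_self, h.siteRefl_mul_self,
      (h.commute_siteRefl_siteRefl j i).eq]
    abel
  have h4 : Q * T - T * Q = -(2 • (T * W)) := by
    rw [h1, mul_sub, mul_smul_comm]
    abel
  have h5 : Q * (T * W) = T * (W * Q) - 4 • (T + T * (siteRefl a i * siteRefl a j)) := by
    rw [← mul_assoc, h1, mul_assoc, sub_mul, smul_mul_assoc, h3, h2, smul_smul, mul_sub,
      mul_smul_comm, mul_add T 1, mul_one]
    norm_num only
  rw [h4, neg_mul, mul_neg, smul_mul_assoc, mul_smul_comm, h5, mul_assoc]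
  abel

/-- The double commutator with the site reflections is a unitary conjugation minus the identity. -/
lemma exists_unitary_double_commutator (h : IsCAR a) : ∃ U ∈ unitary A, ∀ i j σ, i ≠ j →
    ∀ Q T : A, Q = ∑ k, siteRefl a k → T = star (a (i, σ)) * a (j, σ) →
      (Q * T - T * Q) * Q - Q * (Q * T - T * Q) = 8 • (U * T * star U - T) := by
  obtain ⟨U, hU, hUa⟩ := h.exists_unitary Finset.univ
  simp only [Finset.mem_univ, if_true] at hUa
  refine ⟨U, hU, fun i j σ hij Q T hQ hT => ?_⟩
  have h1 : U * T * star U = -(T * (siteRefl a i * siteRefl a j)) := by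
    rw [hT, ← mul_assoc, (hUa i σ).2, mul_assoc _ U, (hUa j σ).1, mul_assoc, mul_assoc,
      (Unitary.mem_iff.1 hU).2, mul_one, mul_assoc, ← mul_assoc (a (j, σ)),
      ← (h.commute_siteRefl hij σ).eq, mul_assoc (siteRefl a i), ← mul_assoc (star _),
      h.star_mul_siteRefl, h.mul_siteRefl, mul_neg, neg_mul]
  rw [h.double_commutator_hop hij σ hQ hT, h1, ← smul_neg]
  congr 1
  abel

end Sites

end IsCAR

/-- First Lemma: for any Hubbard-type Hamiltonian with interaction part
`H_I = (u/4) Σ_i z(i,↑) z(i,↓)` and hopping part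
`H_h = Σ_{i≠j} Σ_σ R i j • (a(i,σ))* a(j,σ)` (with `R` Hermitian, zero
diagonal), one has `‖[[H_I, H_h], H_I]‖ ≤ u² ‖H_h‖`. -/
theorem hubbard_first_lemma
    {A : Type*} [NormedRing A] [StarRing A] [CStarRing A]
    [NormedAlgebra ℂ A] [CompleteSpace A] [StarModule ℂ A]
    {S : Type*} [Fintype S] [DecidableEq S]
    (a : S × Bool → A)
    (hcar1 : ∀ i j, a i * a j + a j * a i = 0)
    (hcar2 : ∀ i j, a i * star (a j) + star (a j) * a i =
      if i = j then 1 else 0)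
    (u : ℝ) (R : Matrix S S ℂ) (hR : R.IsHermitian) (hdiag : ∀ i, R i i = 0)
    (z : S → Bool → A)
    (hz : ∀ i σ, z i σ = 2 • (star (a (i, σ)) * a (i, σ)) - 1)
    (HI Hh : A)
    (hHI : HI = ((u : ℂ) / 4) • ∑ i, z i true * z i false)
    (hHh : Hh = ∑ p ∈ Finset.univ.offDiag,
      ∑ σ, R p.1 p.2 • (star (a (p.1, σ)) * a (p.2, σ))) :
    ‖(HI * Hh - Hh * HI) * HI - HI * ((HI * Hh - Hh * HI))‖ ≤ u ^ 2 * ‖Hh‖ := by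
  have h : IsCAR a := ⟨hcar1, hcar2⟩
  obtain ⟨U, hU, hUT⟩ := h.exists_unitary_double_commutator
  set Q : A := ∑ k, IsCAR.siteRefl a k with hQ
  have hI : HI = ((u : ℂ) / 4) • Q := by
    simp only [hHI, hQ, hz, IsCAR.siteRefl, IsCAR.modeRefl, IsCAR.num]
  let P (X : A) : Prop :=
    (Q * X - X * Q) * Q - Q * (Q * X - X * Q) = (8 : ℂ) • (U * X * star U - X)
  have hadd (X Y : A) (hX : P X) (hY : P Y) : P (X + Y) := by
    have hr : U * (X + Y) * star U - (X + Y) = (U * X * star U - X) + (U * Y * star U - Y) := by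
      noncomm_ring
    simp only [P] at hX hY ⊢
    rw [hr, smul_add, ← hX, ← hY]
    noncomm_ring
  have hD : P Hh := by
    rw [hHh]
    refine Finset.sum_induction _ P hadd (by simp [P]) fun p hp =>
      Finset.sum_induction _ P hadd (by simp [P]) fun σ _ => ?_
    have := hUT p.1 p.2 σ (Finset.mem_offDiag.1 hp).2.2 Q _ hQ rfl
    simp only [P, mul_smul_comm, smul_mul_assoc, ← smul_sub]
    rw [this, smul_comm (8 : ℂ), ← Nat.cast_smul_eq_nsmul ℂ]
    norm_num
  have hcomm : (HI * Hh - Hh * HI) * HI - HI * (HI * Hh - Hh * HI) =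
      ((u ^ 2 / 2 : ℝ) : ℂ) • (U * Hh * star U - Hh) := by
    simp only [hI, mul_smul_comm, smul_mul_assoc, ← smul_sub]
    rw [hD, smul_smul, smul_smul]
    congr 1
    push_cast
    ring
  have hnorm : ‖U * Hh * star U‖ = ‖Hh‖ := by
    rw [CStarRing.norm_mul_mem_unitary _ (Unitary.star_mem hU),
      CStarRing.norm_mem_unitary_mul _ hU]
  calc ‖(HI * Hh - Hh * HI) * HI - HI * (HI * Hh - Hh * HI)‖
      = u ^ 2 / 2 * ‖U * Hh * star U - Hh‖ := by
        rw [hcomm, norm_smul, Complex.norm_real, Real.norm_of_nonneg (by positivity)]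
    _ ≤ u ^ 2 / 2 * (‖U * Hh * star U‖ + ‖Hh‖) := by
        gcongr
        exact norm_sub_le _ _
    _ = u ^ 2 * ‖Hh‖ := by
        rw [hnorm]
        ring
end

section
/- Let R be the adjacency matrix of the 5×5 periodic square lattice, i.e. the matrix indexed by (ZMod 5) × (ZMod 5) with R v w = 1 if v and w differ by a unit vector (±1 in exactly one coordinate, modulo 5) and R v w = 0 otherwise. Let R_star be the matrix with (R_star) v w = R v w if v = (0,0) or w = (0,0), and 0 otherwise. Then the trace norm of the commutator R_star·R − R·R_star (the sum of the absolute values of its eigenvalues, noting that i·(R_star·R − R·R_star) is Hermitian, equivalently the sum of the singular values of R_star·R − R·R_star) equals 4·√5. -/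
/-- The adjacency matrix of the `5 × 5` periodic square lattice: vertices are
`(ZMod 5) × (ZMod 5)`, adjacent iff they differ by `±1` in exactly one
coordinate modulo `5`. -/
noncomputable def latticeMatrix5 :
    Matrix (ZMod 5 × ZMod 5) (ZMod 5 × ZMod 5) ℂ :=
  Matrix.of fun v w =>
    if (v.1 = w.1 ∧ (v.2 = w.2 + 1 ∨ v.2 = w.2 - 1)) ∨
        (v.2 = w.2 ∧ (v.1 = w.1 + 1 ∨ v.1 = w.1 - 1)) then 1 else 0

/-- The restriction of the lattice adjacency matrix to the star at the origin:
entries agree with `latticeMatrix5` when one of the two indices is `(0,0)`,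
and vanish otherwise. -/
noncomputable def starMatrix5 :
    Matrix (ZMod 5 × ZMod 5) (ZMod 5 × ZMod 5) ℂ :=
  Matrix.of fun v w =>
    if v = (0, 0) ∨ w = (0, 0) then latticeMatrix5 v w else 0

section StarCommutator

open Matrix

variable {n : Type*} [Fintype n] [DecidableEq n]

open Unitary in
theorem Matrix.IsHermitian.trace_pow_eq_sum_eigenvalues {A : Matrix n n ℂ} (hA : A.IsHermitian)
    (k : ℕ) : (A ^ k).trace = ∑ i, (hA.eigenvalues i : ℂ) ^ k := by
  conv_lhs => rw [hA.spectral_theorem, ← map_pow, conjStarAlgAut_apply, trace_mul_cycle,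
    coe_star_mul_self, one_mul, diagonal_pow, trace_diagonal]
  simp

theorem Matrix.IsHermitian.eigenvalues_pow_three {A : Matrix n n ℂ} (hA : A.IsHermitian) {c : ℝ}
    (h3 : A ^ 3 = (c : ℂ) • A) (i : n) : hA.eigenvalues i ^ 3 = c * hA.eigenvalues i := by
  have h := congrArg (Unitary.conjStarAlgAut ℂ _ (star hA.eigenvectorUnitary)) h3
  rw [map_pow, map_smul, hA.conjStarAlgAut_star_eigenvectorUnitary, diagonal_pow] at h
  have hi := congrFun₂ h i i
  simp only [diagonal_apply_eq, Matrix.smul_apply, Pi.pow_apply, Function.comp_apply, smul_eq_mul] at hi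
  apply Complex.ofReal_injective
  push_cast
  exact hi

/-- A Hermitian matrix with `A ^ 3 = c A` has eigenvalues in `{0, √c, -√c}`, so that its trace
norm is determined by the trace of `A ^ 2`. -/
theorem Matrix.IsHermitian.sum_abs_eigenvalues_of_pow_three {A : Matrix n n ℂ}
    (hA : A.IsHermitian) {c t : ℝ} (hc : 0 < c) (h3 : A ^ 3 = (c : ℂ) • A)
    (h2 : (A ^ 2).trace = t) : ∑ i, |hA.eigenvalues i| = t / √c := by
  have ht : ∑ i, hA.eigenvalues i ^ 2 = t := by
    rw [hA.trace_pow_eq_sum_eigenvalues] at h2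
    exact_mod_cast h2
  rw [← ht, Finset.sum_div]
  refine Finset.sum_congr rfl fun i _ => ?_
  rw [eq_div_iff (Real.sqrt_pos.2 hc).ne']
  by_cases h0 : hA.eigenvalues i = 0
  · simp [h0]
  · have hsq : hA.eigenvalues i ^ 2 = c :=
      mul_right_cancel₀ h0 (by rw [← hA.eigenvalues_pow_three h3 i]; ring)
    rw [← hsq, Real.sqrt_sq_eq_abs, abs_mul_abs_self, sq]

variable {R : Type*} [CommRing R]

theorem sq_vecMulVec_sub_vecMulVec (u v : n → R) :
    (vecMulVec u v - vecMulVec v u) ^ 2 =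
      (u ⬝ᵥ v) • (vecMulVec u v + vecMulVec v u) - (v ⬝ᵥ v) • vecMulVec u u
        - (u ⬝ᵥ u) • vecMulVec v v := by
  simp only [sq, sub_mul, mul_sub, vecMulVec_mul_vecMulVec, dotProduct_comm v u]
  ext i j
  simp only [Matrix.sub_apply, Matrix.add_apply, Matrix.smul_apply, vecMulVec_apply,
    Pi.smul_apply, smul_eq_mul]
  ring

theorem pow_three_vecMulVec_sub_vecMulVec (u v : n → R) :
    (vecMulVec u v - vecMulVec v u) ^ 3 =
      ((u ⬝ᵥ v) ^ 2 - (u ⬝ᵥ u) * (v ⬝ᵥ v)) • (vecMulVec u v - vecMulVec v u) := by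
  rw [pow_succ, sq_vecMulVec_sub_vecMulVec]
  simp only [sub_mul, mul_sub, add_mul, smul_mul_assoc, vecMulVec_mul_vecMulVec,
    dotProduct_comm v u]
  ext i j
  simp only [Matrix.sub_apply, Matrix.add_apply, Matrix.smul_apply, vecMulVec_apply,
    Pi.smul_apply, smul_eq_mul]
  ring

/-- The trace norm of `I (u vᵀ - v uᵀ)` is twice the square root of the Gram determinant. -/
theorem sum_abs_eigenvalues_vecMulVec_sub_vecMulVec {u v : n → ℂ} {c : ℝ} (hc : 0 < c)
    (hgram : (u ⬝ᵥ u) * (v ⬝ᵥ v) - (u ⬝ᵥ v) ^ 2 = c)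
    (h : (Complex.I • (vecMulVec u v - vecMulVec v u)).IsHermitian) :
    ∑ i, |h.eigenvalues i| = 2 * √c := by
  rw [h.sum_abs_eigenvalues_of_pow_three (c := c) (t := 2 * c) hc, mul_div_assoc,
    Real.div_sqrt]
  · rw [_root_.smul_pow, pow_three_vecMulVec_sub_vecMulVec, smul_smul, smul_smul, ← hgram,
      Complex.I_pow_three]
    congr 1
    ring
  · rw [_root_.smul_pow, sq_vecMulVec_sub_vecMulVec, Complex.I_sq]
    simp only [trace_smul, trace_sub, trace_add, trace_vecMulVec, smul_eq_mul, dotProduct_comm v u]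
    push_cast
    rw [← hgram]
    ring

/-- The commutator of a symmetric matrix with its restriction to the star of a vertex `o` without
loop has rank at most two. -/
theorem star_commutator_eq_vecMulVec_sub_vecMulVec {M S : Matrix n n R} (hM : M.IsSymm) (o : n)
    (ho : M o o = 0) (hS : ∀ v w, S v w = if v = o ∨ w = o then M v w else 0) :
    S * M - M * S =
      vecMulVec (Pi.single o 1) (M *ᵥ M.col o) - vecMulVec (M *ᵥ M.col o) (Pi.single o 1) := by
  have hS' : S = vecMulVec (Pi.single o 1) (M.col o) + vecMulVec (M.col o) (Pi.single o 1) := by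
    ext v w
    have := hM.apply v w
    by_cases hv : v = o <;> by_cases hw : w = o <;>
      simp_all [vecMulVec_apply, hM.apply]
  have h1 : M.col o ᵥ* M = M *ᵥ M.col o := by
    rw [← mulVec_transpose, hM.eq]
  have h2 : (Pi.single o 1 : n → R) ᵥ* M = M.col o := by
    rw [← mulVec_transpose, hM.eq, mulVec_single_one]
  rw [hS', add_mul, mul_add, vecMulVec_mul, vecMulVec_mul, mul_vecMulVec, mul_vecMulVec, h1, h2,
    mulVec_single_one]
  abel

/-- The number of walks of length two from the origin to a vertex of the lattice. -/
def walksFromOrigin (v : ZMod 5 × ZMod 5) : ℕ :=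
  (Finset.univ.filter fun w : ZMod 5 × ZMod 5 =>
    ((v.1 = w.1 ∧ (v.2 = w.2 + 1 ∨ v.2 = w.2 - 1)) ∨
      (v.2 = w.2 ∧ (v.1 = w.1 + 1 ∨ v.1 = w.1 - 1))) ∧
    ((w.1 = 0 ∧ (w.2 = 0 + 1 ∨ w.2 = 0 - 1)) ∨
      (w.2 = 0 ∧ (w.1 = 0 + 1 ∨ w.1 = 0 - 1)))).card

theorem latticeMatrix5_mulVec_col :
    latticeMatrix5 *ᵥ latticeMatrix5.col (0, 0) = fun v => (walksFromOrigin v : ℂ) := by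
  ext v
  simp only [mulVec, dotProduct, col_apply, latticeMatrix5, of_apply, walksFromOrigin,
    Finset.card_filter, Nat.cast_sum, Nat.cast_ite, Nat.cast_one, Nat.cast_zero,
    ite_zero_mul_ite_zero, mul_one]

theorem latticeMatrix5_isSymm : latticeMatrix5.IsSymm := by
  ext v w
  simp only [transpose_apply, latticeMatrix5, of_apply]
  refine if_congr ?_ rfl rfl
  grind

end StarCommutator

/-- The trace norm of the commutator `R_star·R − R·R_star` on the `5 × 5`
periodic square lattice equals `4·√5`.  Since the commutator is
anti-Hermitian, `i` times it is Hermitian, and its trace norm is the sum of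
the absolute values of the eigenvalues of that Hermitian matrix. -/
theorem lattice_star_commutator_traceNorm
    (h : (Complex.I • (starMatrix5 * latticeMatrix5
      - latticeMatrix5 * starMatrix5)).IsHermitian) :
    ∑ v, |h.eigenvalues v| = 4 * Real.sqrt 5 := by
  have hC := star_commutator_eq_vecMulVec_sub_vecMulVec (S := starMatrix5)
    latticeMatrix5_isSymm (0, 0) (by simp +decide [latticeMatrix5]) fun _ _ => rfl
  rw [latticeMatrix5_mulVec_col] at hC
  have h0 : walksFromOrigin (0, 0) = 4 := by decide +kernel
  have hsum : ∑ v, walksFromOrigin v * walksFromOrigin v = 36 := by decide +kernel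
  have hsum' : (∑ v, walksFromOrigin v * walksFromOrigin v : ℂ) = 36 := by exact_mod_cast hsum
  have key := sum_abs_eigenvalues_vecMulVec_sub_vecMulVec
    (u := Pi.single (0, 0) 1) (v := fun v => (walksFromOrigin v : ℂ)) (c := 20) (by norm_num)
    (by
      rw [single_one_dotProduct, single_one_dotProduct, dotProduct, hsum', h0]
      simp
      norm_num)
    (hC ▸ h)
  simp only [hC]
  rw [key, show (20 : ℝ) = 2 ^ 2 * 5 by norm_num, Real.sqrt_mul (by norm_num),
    Real.sqrt_sq (by norm_num)]
  ring
end

section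
/- (Corollary for the square-lattice Hubbard model.) Let L ≥ 4, let A be a unital C*-algebra over ℂ and let (a (v, σ)) be a family indexed by ((ZMod L) × (ZMod L)) × Bool satisfying the CAR. Let u ≥ 0 and τ > 0 be real, let R v w := τ if sites v, w are nearest neighbors on the L×L periodic square lattice and 0 otherwise, and define z (v,σ) := 2 • (a (v,σ))* * a (v,σ) − 1, H_I := (u/4) • Σ_v z (v,↑)*z (v,↓), and H_h := Σ_{v ≠ w} Σ_σ (R v w) • (a (v,σ))* * a (w,σ). Then ‖[[H_I, H_h], H_h]‖ ≤ u·τ²·L²·(2·√5 + 16). -/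
section
variable {A : Type*} [NormedRing A] [StarRing A] [CStarRing A] [NormedAlgebra ℂ A] [StarModule ℂ A]

lemma mul_mul_of_eq {R : Type*} [Ring R] {x y w : R} (h : x * y = w) (t : R) : x * (y * t) = w * t := by
  rw [← mul_assoc, h]

omit [StarModule ℂ A] in
lemma IsSelfAdjoint.norm_sq_le_of_cube_eq_smul {K : A} (hK : IsSelfAdjoint K) {c : ℝ} (hc : 0 ≤ c)
    (h : K * (K * K) = c • K) : ‖K‖ ^ 2 ≤ c := by
  have h2 : ‖K * K‖ = ‖K‖ ^ 2 := by
    rw [sq]; nth_rw 1 [← hK.star_eq]; exact CStarRing.norm_star_mul_self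
  have h4 : ‖K * K * (K * K)‖ = ‖K * K‖ ^ 2 := by
    rw [sq]
    have : star (K * K) = K * K := by rw [star_mul, hK.star_eq]
    nth_rw 1 [← this]; exact CStarRing.norm_star_mul_self
  rw [mul_assoc, h, mul_smul_comm, norm_smul, h2, Real.norm_of_nonneg hc] at h4
  rcases eq_or_ne (‖K‖ ^ 2) 0 with h0 | h0
  · rw [h0]; exact hc
  · have : 0 < ‖K‖ ^ 2 := lt_of_le_of_ne (by positivity) h0.symm
    nlinarith

lemma hopping_cube {R : Type*} [Ring R] [Algebra ℝ R] {f F g G : R} {α β : ℝ}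
    (hff : f * f = 0) (hFF : F * F = 0) (hgg : g * g = 0) (hGG : G * G = 0)
    (hgf : g * f = -(f * g)) (hgF : g * F = -(F * g)) (hGf : G * f = -(f * G))
    (hGF : G * F = -(F * G)) (hfF : f * F = α • 1 - F * f) (hgG : g * G = β • 1 - G * g) :
    (F * g + G * f) * ((F * g + G * f) * (F * g + G * f)) = (α * β) • (F * g + G * f) := by
  simp only [mul_add, add_mul, sub_mul, mul_sub, mul_assoc, hgg, hGG, hgf, hGf, hgG,
    mul_mul_of_eq hff, mul_mul_of_eq hFF, mul_mul_of_eq hGG, mul_mul_of_eq hgf,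
    mul_mul_of_eq hgF, mul_mul_of_eq hGf, mul_mul_of_eq hGF, mul_mul_of_eq hfF,
    mul_mul_of_eq hgG, mul_neg, neg_mul, mul_smul_comm, smul_mul_assoc, one_mul, mul_one, zero_mul,
    mul_zero, neg_zero, sub_zero, smul_zero, neg_neg, smul_neg, zero_add, add_zero]
  module

lemma number_reflection_anticomm {R : Type*} [Ring R] {f F g G : R}
    (hff : f * f = 0) (hFF : F * F = 0)
    (hgf : g * f = -(f * g)) (hgF : g * F = -(F * g)) (hGf : G * f = -(f * G))
    (hGF : G * F = -(F * G)) (hfF : f * F = 1 - F * f) :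
    (2 * (F * f) - 1) * (F * g + G * f) + (F * g + G * f) * (2 * (F * f) - 1) = 0 := by
  simp only [two_mul, mul_add, add_mul, mul_sub, sub_mul, mul_assoc, hgf, hGf,
    mul_mul_of_eq hff, mul_mul_of_eq hFF, mul_mul_of_eq hgF, mul_mul_of_eq hGF,
    mul_mul_of_eq hfF, mul_neg, neg_mul, one_mul, mul_one, zero_mul, mul_zero, sub_zero,
    zero_sub, neg_neg, zero_add, add_zero]
  abel

omit [StarModule ℂ A] in
lemma norm_hopping_sq_le {f g : A} {α β : ℝ} (hα : 0 ≤ α) (hβ : 0 ≤ β)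
    (hff : f * f = 0) (hgg : g * g = 0)
    (hgf : g * f + f * g = 0) (hgF : g * star f + star f * g = 0)
    (hfF : f * star f + star f * f = α • 1) (hgG : g * star g + star g * g = β • 1) :
    ‖star f * g + star g * f‖ ^ 2 ≤ α * β := by
  have hs : IsSelfAdjoint (star f * g + star g * f) := by
    simp [IsSelfAdjoint, add_comm]
  refine hs.norm_sq_le_of_cube_eq_smul (mul_nonneg hα hβ) ?_
  have h1 : star g * star f + star f * star g = 0 := by simpa [add_comm] using congrArg star hgf
  have h2 : star g * f + f * star g = 0 := by simpa [add_comm] using congrArg star hgF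
  exact hopping_cube hff (by simpa using congrArg star hff) hgg (by simpa using congrArg star hgg)
    (eq_neg_of_add_eq_zero_left hgf) (eq_neg_of_add_eq_zero_left hgF) (eq_neg_of_add_eq_zero_left h2)
    (eq_neg_of_add_eq_zero_left h1) (eq_sub_of_add_eq hfF) (eq_sub_of_add_eq hgG)

lemma norm_skew_hopping_sq_le {f g : A} {α β : ℝ} (hα : 0 ≤ α) (hβ : 0 ≤ β)
    (hff : f * f = 0) (hgg : g * g = 0)
    (hgf : g * f + f * g = 0) (hgF : g * star f + star f * g = 0)
    (hfF : f * star f + star f * f = α • 1) (hgG : g * star g + star g * g = β • 1) :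
    ‖star f * g - star g * f‖ ^ 2 ≤ α * β := by
  have h := norm_hopping_sq_le (f := f) (g := Complex.I • g) hα hβ hff (by simp [hgg])
    (by simp [← smul_add, hgf]) (by simp [← smul_add, hgF]) hfF
    (by simpa [smul_smul] using hgG)
  have e : star f * (Complex.I • g) + star (Complex.I • g) * f
      = Complex.I • (star f * g - star g * f) := by
    simp [sub_eq_add_neg]
  rwa [e, norm_smul, Complex.norm_I, one_mul] at h

/-- If `g` is a fermionic mode of squared norm `β`, then `β - 2 g⋆g` has norm at most `β`. -/
lemma norm_reflection_le {g : A} {β : ℝ} (hβ : 0 ≤ β) (hgg : g * g = 0)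
    (hgG : g * star g + star g * g = β • 1) : ‖β • (1 : A) - 2 • (star g * g)‖ ≤ β := by
  have hs : IsSelfAdjoint (β • (1 : A) - 2 • (star g * g)) := by
    simp [IsSelfAdjoint, two_smul]
  refine (sq_le_sq₀ (norm_nonneg _) hβ).1 (hs.norm_sq_le_of_cube_eq_smul (sq_nonneg β) ?_)
  have h : g * (star g * g) = β • g := by
    rw [← mul_assoc, eq_sub_of_add_eq hgG, sub_mul, mul_assoc, hgg]; simp
  have e : (β • (1 : A) - 2 • (star g * g)) * (β • (1 : A) - 2 • (star g * g)) = β ^ 2 • 1 := by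
    simp only [sub_mul, mul_sub, smul_mul_assoc, mul_smul_comm, one_mul, mul_one, mul_assoc, h]
    module
  rw [e, mul_smul_comm, mul_one]

lemma norm_number_reflection_add_hopping_sq_le {f x : A} {d s : ℝ} (hs : 0 ≤ s)
    (hff : f * f = 0) (hxx : x * x = 0)
    (hxf : x * f + f * x = 0) (hxF : x * star f + star f * x = 0)
    (hfF : f * star f + star f * f = 1) (hxX : x * star x + star x * x = s • 1) :
    ‖d • (2 * (star f * f) - 1) + (star f * x + star x * f)‖ ^ 2 ≤ d ^ 2 + s := by
  have hK := norm_hopping_sq_le zero_le_one hs hff hxx hxf hxF (by simpa using hfF) hxX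
  have hz := norm_reflection_le zero_le_one hff (by simpa using hfF)
  have h1 : star x * star f + star f * star x = 0 := by simpa [add_comm] using congrArg star hxf
  have h2 : star x * f + f * star x = 0 := by simpa [add_comm] using congrArg star hxF
  have hanti := number_reflection_anticomm (G := star x) hff (by simpa using congrArg star hff)
    (eq_neg_of_add_eq_zero_left hxf) (eq_neg_of_add_eq_zero_left hxF) (eq_neg_of_add_eq_zero_left h2)
    (eq_neg_of_add_eq_zero_left h1) (eq_sub_of_add_eq hfF)
  have hz' : ‖2 * (star f * f) - 1‖ ≤ 1 := by
    rw [norm_sub_rev]; simpa [two_mul, two_smul] using hz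
  have hzs : IsSelfAdjoint (2 * (star f * f) - 1) := by
    simp [IsSelfAdjoint, two_mul]
  have hKs : IsSelfAdjoint (star f * x + star x * f) := by
    simp [IsSelfAdjoint, add_comm]
  generalize 2 * (star f * f) - 1 = z at *
  generalize star f * x + star x * f = K at *
  have hW : star (d • z + K) * (d • z + K) = d ^ 2 • (z * z) + K * K := by
    have : K * z = -(z * K) := eq_neg_of_add_eq_zero_right hanti
    simp only [star_add, star_smul, star_trivial, hzs.star_eq, hKs.star_eq, mul_add, add_mul,
      smul_mul_assoc, mul_smul_comm, this]
    module
  calc ‖d • z + K‖ ^ 2 = ‖d ^ 2 • (z * z) + K * K‖ := by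
        rw [← hW, CStarRing.norm_star_mul_self, sq]
    _ ≤ d ^ 2 * (‖z‖ * ‖z‖) + ‖K‖ * ‖K‖ := by
        refine (norm_add_le _ _).trans (add_le_add ?_ (norm_mul_le _ _))
        rw [norm_smul, Real.norm_of_nonneg (sq_nonneg d)]
        gcongr
        exact norm_mul_le _ _
    _ ≤ d ^ 2 + s := by
        have : ‖z‖ * ‖z‖ ≤ 1 := mul_le_one₀ hz' (norm_nonneg _) hz'
        nlinarith [sq_nonneg d]

section Smear

variable {I : Type*} [Fintype I] [DecidableEq I] {a : I → A}

/-- The mode `∑ i, φ i • a i`. -/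
noncomputable def smear (a : I → A) (φ : I → ℝ) : A := ∑ i, φ i • a i

/-- The quadratic Hamiltonian `∑ i j, M i j • (a i)⋆ * a j`. -/
noncomputable def quadraticHamiltonian (a : I → A) (M : Matrix I I ℝ) : A :=
  ∑ i, ∑ j, M i j • (star (a i) * a j)

omit [StarRing A] [CStarRing A] [StarModule ℂ A] in
lemma smear_single (i : I) : smear a (Pi.single i 1) = a i := by
  simp [smear, Pi.single_apply, ite_smul]

omit [StarRing A] [CStarRing A] [StarModule ℂ A] [DecidableEq I] in
lemma smear_sub_smul (φ ψ : I → ℝ) (c : ℝ) :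
    smear a (φ - c • ψ) = smear a φ - c • smear a ψ := by
  simp [smear, sub_smul, Finset.sum_sub_distrib, Finset.smul_sum, smul_smul]

omit [StarRing A] [CStarRing A] [StarModule ℂ A] [DecidableEq I] in
lemma smear_anticomm (hcar1 : ∀ i j, a i * a j + a j * a i = 0) (φ ψ : I → ℝ) :
    smear a φ * smear a ψ + smear a ψ * smear a φ = 0 := by
  simp only [smear, Finset.sum_mul_sum]
  rw [Finset.sum_comm (f := fun i j => ψ i • a i * φ j • a j), ← Finset.sum_add_distrib]
  refine Finset.sum_eq_zero fun i _ => ?_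
  rw [← Finset.sum_add_distrib]
  refine Finset.sum_eq_zero fun j _ => ?_
  rw [smul_mul_smul_comm, smul_mul_smul_comm, mul_comm (ψ j), ← smul_add, hcar1, smul_zero]

omit [StarRing A] [CStarRing A] [StarModule ℂ A] [DecidableEq I] in
lemma smear_mul_self (hcar1 : ∀ i j, a i * a j + a j * a i = 0) (φ : I → ℝ) :
    smear a φ * smear a φ = 0 := by
  have h := smear_anticomm hcar1 φ φ
  rw [← two_smul ℝ] at h
  exact (smul_eq_zero.1 h).resolve_left two_ne_zero

omit [CStarRing A] in
lemma smear_star_anticomm (hcar2 : ∀ i j, a i * star (a j) + star (a j) * a i =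
    if i = j then 1 else 0) (φ ψ : I → ℝ) :
    smear a φ * star (smear a ψ) + star (smear a ψ) * smear a φ = (φ ⬝ᵥ ψ) • (1 : A) := by
  simp only [smear, star_sum, Finset.sum_mul_sum, star_smul, star_trivial]
  rw [Finset.sum_comm (f := fun i j => ψ i • star (a i) * φ j • a j), ← Finset.sum_add_distrib,
    dotProduct, Finset.sum_smul]
  refine Finset.sum_congr rfl fun i _ => ?_
  rw [← Finset.sum_add_distrib]
  simp only [smul_mul_smul_comm, mul_comm (ψ _), ← smul_add, hcar2]
  simp

omit [CStarRing A] [DecidableEq I] in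
lemma isSelfAdjoint_quadraticHamiltonian {M : Matrix I I ℝ} (hM : M.IsSymm) :
    IsSelfAdjoint (quadraticHamiltonian a M) := by
  simp only [IsSelfAdjoint, quadraticHamiltonian, star_sum, star_smul, star_trivial, star_mul,
    star_star]
  rw [Finset.sum_comm]
  simp only [hM.apply]

omit [CStarRing A] [StarModule ℂ A] in
lemma smear_mul_quadraticHamiltonian (hcar1 : ∀ i j, a i * a j + a j * a i = 0)
    (hcar2 : ∀ i j, a i * star (a j) + star (a j) * a i = if i = j then 1 else 0)
    (M : Matrix I I ℝ) (φ : I → ℝ) :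
    smear a φ * quadraticHamiltonian a M - quadraticHamiltonian a M * smear a φ =
      smear a (Matrix.vecMul φ M) := by
  have key : ∀ k i j, a k * (star (a i) * a j) - star (a i) * a j * a k =
      if k = i then a j else 0 := by
    intro k i j
    have : a k * (star (a i) * a j) - star (a i) * a j * a k =
        (a k * star (a i) + star (a i) * a k) * a j - star (a i) * (a j * a k + a k * a j) := by
      noncomm_ring
    rw [this, hcar1, hcar2]
    split_ifs <;> simp
  simp only [smear, quadraticHamiltonian, Matrix.vecMul, dotProduct, Finset.sum_smul]
  conv_rhs => rw [Finset.sum_comm]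
  rw [Finset.sum_mul, Finset.mul_sum, ← Finset.sum_sub_distrib]
  refine Finset.sum_congr rfl fun k _ => ?_
  simp only [Finset.mul_sum, Finset.sum_mul, ← Finset.sum_sub_distrib, smul_mul_smul_comm]
  have : ∀ i j, (φ k * M i j) • (a k * (star (a i) * a j)) -
      (M i j * φ k) • (star (a i) * a j * a k) = (φ k * M i j) • if k = i then a j else 0 := by
    intro i j
    rw [mul_comm (M i j), ← smul_sub, key]
  simp only [this]
  rw [Finset.sum_comm]
  simp [Finset.sum_ite_eq]

/-- Norm bounds for `z = 2 a⋆a - 1` and its first two commutators with a quadratic Hamiltonian whose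
rows at `i` have squared norm `d` and `Y` for `M` and `M * M`. -/
lemma norm_commutators_le (hcar1 : ∀ i j, a i * a j + a j * a i = 0)
    (hcar2 : ∀ i j, a i * star (a j) + star (a j) * a i = if i = j then 1 else 0)
    {M : Matrix I I ℝ} (hM : M.IsSymm) (i : I) (hii : M i i = 0) {t : ℝ} (ht : 0 ≤ t)
    (hd : M i ⬝ᵥ M i ≤ 4 * t ^ 2) (hY : (M * M) i ⬝ᵥ (M * M) i ≤ 64 * t ^ 4)
    {H z : A} (hH : H = quadraticHamiltonian a M) (hz : z = 2 • (star (a i) * a i) - 1) :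
    ‖z‖ ≤ 1 ∧ ‖z * H - H * z‖ ≤ 4 * t ∧
      ‖(z * H - H * z) * H - H * (z * H - H * z)‖ ≤ 24 * t ^ 2 := by
  set f := smear a (Pi.single i 1) with hf
  set r := smear a (M i) with hr
  set y := smear a ((M * M) i) with hy
  set d := M i ⬝ᵥ M i with hd'
  set Y := (M * M) i ⬝ᵥ (M * M) i with hY'
  have hd0 : 0 ≤ d := Finset.sum_nonneg fun _ _ => mul_self_nonneg _
  have hfr : f * H - H * f = r := by
    rw [hf, hH, smear_mul_quadraticHamiltonian hcar1 hcar2, Matrix.single_one_vecMul]; rfl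
  have hry : r * H - H * r = y := by
    rw [hr, hH, smear_mul_quadraticHamiltonian hcar1 hcar2, ← Matrix.mul_apply_eq_vecMul]
  have hHs : star H = H := by rw [hH]; exact isSelfAdjoint_quadraticHamiltonian hM
  have hfr' : H * star f - star f * H = star r := by
    rw [← hfr]; simp [hHs]
  have hry' : H * star r - star r * H = star y := by
    rw [← hry]; simp [hHs]
  have hfF : f * star f + star f * f = 1 := by
    rw [smear_star_anticomm hcar2]; simp
  have hff : f * f = 0 := smear_mul_self hcar1 _
  have hrr : r * r = 0 := smear_mul_self hcar1 _
  have hrR : r * star r + star r * r = d • 1 := smear_star_anticomm hcar2 _ _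
  have hrf : r * f + f * r = 0 := smear_anticomm hcar1 _ _
  have hrF : r * star f + star f * r = 0 := by
    rw [smear_star_anticomm hcar2]; simp [hii]
  have hMM : (M * M) i i = d := by
    rw [Matrix.mul_apply, hd', dotProduct]
    exact Finset.sum_congr rfl fun j _ => by rw [hM.apply i j]
  rw [← smear_single (a := a) i, ← hf] at hz
  have hz2 : z = 2 * (star f * f) - 1 := by rw [hz, two_smul, two_mul]
  have hC : z * H - H * z = 2 • (star f * r - star r * f) := by
    rw [hz2, ← hfr', ← hfr]
    noncomm_ring
  have hD : (z * H - H * z) * H - H * (z * H - H * z) =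
      2 • (star f * y + star y * f - 2 • (star r * r)) := by
    have e : (star f * r - star r * f) * H - H * (star f * r - star r * f) =
        star f * (r * H - H * r) - (H * star f - star f * H) * r
        - star r * (f * H - H * f) + (H * star r - star r * H) * f := by
      noncomm_ring
    rw [hC, smul_mul_assoc, mul_smul_comm, ← smul_sub, e, hfr, hfr', hry, hry']
    congr 1
    rw [two_smul]
    abel
  refine ⟨?_, ?_, ?_⟩
  · have := norm_reflection_le zero_le_one hff (by simpa using hfF)
    rw [hz, norm_sub_rev]
    simpa using this
  · have h := norm_skew_hopping_sq_le zero_le_one hd0 hff hrr hrf hrF (by simpa using hfF) hrR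
    have h2 : ‖star f * r - star r * f‖ ≤ 2 * t :=
      (sq_le_sq₀ (norm_nonneg _) (by positivity)).1 (by linarith)
    rw [hC, two_smul]
    exact (norm_add_le _ _).trans (by linarith)
  · set x := smear a ((M * M) i - d • Pi.single i 1) with hx
    have hyx : y = x + d • f := by rw [hx, smear_sub_smul]; simp [hy, hf]
    have hxF : x * star f + star f * x = 0 := by
      rw [smear_star_anticomm hcar2]; simp [hMM]
    have hxX : x * star x + star x * x = (Y - d ^ 2) • 1 := by
      rw [smear_star_anticomm hcar2]
      congr 1
      simp only [sub_dotProduct, dotProduct_sub, smul_dotProduct, dotProduct_smul, smul_eq_mul,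
        dotProduct_single, single_dotProduct]
      simp [hY', hMM, sq]
    have hs : 0 ≤ Y - d ^ 2 := by
      have : d ^ 2 ≤ Y := by
        rw [hY', ← hMM, sq]
        exact Finset.single_le_sum (f := fun j => (M * M) i j * (M * M) i j)
          (fun j _ => mul_self_nonneg _) (Finset.mem_univ i)
      linarith
    have hW := norm_number_reflection_add_hopping_sq_le (d := d) hs hff (smear_mul_self hcar1 _)
      (smear_anticomm hcar1 _ _) hxF hfF hxX
    have hW' : ‖d • (2 * (star f * f) - 1) + (star f * x + star x * f)‖ ≤ 8 * t ^ 2 :=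
      (sq_le_sq₀ (norm_nonneg _) (by positivity)).1 (by linarith)
    have hT := norm_reflection_le hd0 hrr hrR
    have e : star f * y + star y * f - 2 • (star r * r) =
        (d • (2 * (star f * f) - 1) + (star f * x + star x * f))
          + (d • (1 : A) - 2 • (star r * r)) := by
      rw [hyx]
      simp only [star_add, star_smul, star_trivial, mul_add, add_mul, mul_smul_comm,
        smul_mul_assoc, two_mul]
      module
    rw [hD, e, two_smul]
    refine (norm_add_le _ _).trans ?_
    linarith [norm_add_le (d • (2 * (star f * f) - 1) + (star f * x + star x * f))
      (d • (1 : A) - 2 • (star r * r))]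

end Smear


/-- If `z₁`, `z₂` are contractions whose first two commutators with `H` are bounded by `c` and `e`,
then the double commutator of `z₁ * z₂` with `H` is bounded by `2 * e + 2 * c ^ 2`. -/
lemma norm_double_commutator_mul_le {R : Type*} [NormedRing R] {z₁ z₂ H : R} {c e : ℝ}
    (h₁ : ‖z₁‖ ≤ 1 ∧ ‖z₁ * H - H * z₁‖ ≤ c ∧
      ‖(z₁ * H - H * z₁) * H - H * (z₁ * H - H * z₁)‖ ≤ e)
    (h₂ : ‖z₂‖ ≤ 1 ∧ ‖z₂ * H - H * z₂‖ ≤ c ∧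
      ‖(z₂ * H - H * z₂) * H - H * (z₂ * H - H * z₂)‖ ≤ e) :
    ‖(z₁ * z₂ * H - H * (z₁ * z₂)) * H - H * (z₁ * z₂ * H - H * (z₁ * z₂))‖ ≤
      2 * e + 2 * c ^ 2 := by
  obtain ⟨hz₁, hc₁, he₁⟩ := h₁
  obtain ⟨hz₂, hc₂, he₂⟩ := h₂
  have hc : 0 ≤ c := (norm_nonneg _).trans hc₁
  have he : 0 ≤ e := (norm_nonneg _).trans he₁
  have key : (z₁ * z₂ * H - H * (z₁ * z₂)) * H - H * (z₁ * z₂ * H - H * (z₁ * z₂)) =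
      ((z₁ * H - H * z₁) * H - H * (z₁ * H - H * z₁)) * z₂
      + (z₁ * H - H * z₁) * (z₂ * H - H * z₂) + (z₁ * H - H * z₁) * (z₂ * H - H * z₂)
      + z₁ * ((z₂ * H - H * z₂) * H - H * (z₂ * H - H * z₂)) := by
    noncomm_ring
  have hcc : ‖(z₁ * H - H * z₁) * (z₂ * H - H * z₂)‖ ≤ c * c := norm_mul_le_of_le hc₁ hc₂
  rw [key]
  refine norm_add₄_le.trans ?_
  linarith [norm_mul_le_of_le he₁ hz₂, norm_mul_le_of_le hz₁ he₂]

end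

section Lattice

variable {L : ℕ}

/-- The hopping strength between two sites of the periodic square lattice. -/
noncomputable def squareHopping (τ : ℝ) (v w : ZMod L × ZMod L) : ℝ :=
  if (v.1 = w.1 ∧ (v.2 = w.2 + 1 ∨ v.2 = w.2 - 1)) ∨
    (v.2 = w.2 ∧ (v.1 = w.1 + 1 ∨ v.1 = w.1 - 1)) then τ else 0

lemma squareHopping_comm (τ : ℝ) (v w : ZMod L × ZMod L) :
    squareHopping τ v w = squareHopping τ w v := by
  unfold squareHopping
  congr 1
  grind

lemma squareHopping_self [Fact (1 < L)] (τ : ℝ) (v : ZMod L × ZMod L) :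
    squareHopping τ v v = 0 := by
  simp [squareHopping, sub_eq_add_neg]

lemma squareHopping_nonneg {τ : ℝ} (hτ : 0 ≤ τ) (v w : ZMod L × ZMod L) :
    0 ≤ squareHopping τ v w := by
  unfold squareHopping; split_ifs <;> simp [hτ]

lemma squareHopping_le {τ : ℝ} (hτ : 0 ≤ τ) (v w : ZMod L × ZMod L) :
    squareHopping τ v w ≤ τ := by
  unfold squareHopping; split_ifs <;> simp [hτ]

lemma sum_squareHopping_le [NeZero L] {τ : ℝ} (hτ : 0 ≤ τ) (v : ZMod L × ZMod L) :
    ∑ w, squareHopping τ v w ≤ 4 * τ := by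
  unfold squareHopping
  rw [← Finset.sum_filter, Finset.sum_const, nsmul_eq_mul]
  gcongr
  have hsub : Finset.univ.filter (fun w : ZMod L × ZMod L =>
      (v.1 = w.1 ∧ (v.2 = w.2 + 1 ∨ v.2 = w.2 - 1)) ∨
        (v.2 = w.2 ∧ (v.1 = w.1 + 1 ∨ v.1 = w.1 - 1))) ⊆
      {(v.1, v.2 - 1), (v.1, v.2 + 1), (v.1 - 1, v.2), (v.1 + 1, v.2)} := by
    rintro ⟨x, y⟩ h
    simp only [Finset.mem_filter, Finset.mem_univ, true_and, Finset.mem_insert,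
      Finset.mem_singleton, Prod.mk.injEq] at h ⊢
    grind
  exact_mod_cast (Finset.card_le_card hsub).trans Finset.card_le_four

/-- The hopping matrix on sites with spin. -/
noncomputable def spinHopping (L : ℕ) (τ : ℝ) :
    Matrix ((ZMod L × ZMod L) × Bool) ((ZMod L × ZMod L) × Bool) ℝ :=
  fun i j => if i.2 = j.2 then squareHopping τ i.1 j.1 else 0

lemma isSymm_spinHopping (τ : ℝ) : (spinHopping L τ).IsSymm := by
  ext i j
  simp [Matrix.transpose_apply, spinHopping, squareHopping_comm τ i.1, eq_comm]

lemma spinHopping_nonneg {τ : ℝ} (hτ : 0 ≤ τ) (i j) : 0 ≤ spinHopping L τ i j := by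
  unfold spinHopping; split_ifs <;> simp [squareHopping_nonneg hτ]

lemma spinHopping_le {τ : ℝ} (hτ : 0 ≤ τ) (i j) : spinHopping L τ i j ≤ τ := by
  unfold spinHopping; split_ifs <;> simp [squareHopping_le hτ, hτ]

lemma sum_spinHopping_le [NeZero L] {τ : ℝ} (hτ : 0 ≤ τ) (i) :
    ∑ j, spinHopping L τ i j ≤ 4 * τ := by
  rw [Fintype.sum_prod_type]
  simpa [spinHopping] using sum_squareHopping_le hτ i.1

end Lattice

lemma dotProduct_self_le {I : Type*} [Fintype I] {φ : I → ℝ} {s m : ℝ} (h0 : ∀ i, 0 ≤ φ i)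
    (hm : ∀ i, φ i ≤ m) (hm0 : 0 ≤ m) (hs : ∑ i, φ i ≤ s) : φ ⬝ᵥ φ ≤ m * s :=
  calc φ ⬝ᵥ φ ≤ ∑ i, m * φ i :=
        Finset.sum_le_sum fun i _ => mul_le_mul_of_nonneg_right (hm i) (h0 i)
    _ ≤ m * s := by rw [← Finset.mul_sum]; gcongr

lemma mul_self_row_dotProduct_le {I : Type*} [Fintype I] {M : Matrix I I ℝ} {s m : ℝ}
    (h0 : ∀ i j, 0 ≤ M i j) (hm : ∀ i j, M i j ≤ m) (hm0 : 0 ≤ m) (hs0 : 0 ≤ s)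
    (hs : ∀ i, ∑ j, M i j ≤ s) (i : I) :
    (M * M) i ⬝ᵥ (M * M) i ≤ s * m * (s * s) := by
  refine dotProduct_self_le (fun j => ?_) (fun j => ?_) (by positivity) ?_
  · exact Finset.sum_nonneg fun k _ => mul_nonneg (h0 i k) (h0 k j)
  · rw [Matrix.mul_apply]
    calc ∑ k, M i k * M k j ≤ ∑ k, M i k * m :=
          Finset.sum_le_sum fun k _ => mul_le_mul_of_nonneg_left (hm k j) (h0 i k)
      _ ≤ s * m := by rw [← Finset.sum_mul]; gcongr; exact hs i
  · simp only [Matrix.mul_apply]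
    rw [Finset.sum_comm]
    calc ∑ k, ∑ j, M i k * M k j ≤ ∑ k, M i k * s := by
          refine Finset.sum_le_sum fun k _ => ?_
          rw [← Finset.mul_sum]
          exact mul_le_mul_of_nonneg_left (hs k) (h0 i k)
      _ ≤ s * s := by rw [← Finset.sum_mul]; gcongr; exact hs i


/-- Corollary for the square-lattice Hubbard model: on the `L × L` periodic
square lattice (`L ≥ 4`) with interaction strength `u ≥ 0` and hopping
strength `τ > 0`, the nested commutator of the interaction and hopping
Hamiltonians satisfies `‖[[H_I, H_h], H_h]‖ ≤ u τ² L² (2√5 + 16)`. -/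
theorem hubbard_square_lattice_corollary
    {A : Type*} [NormedRing A] [StarRing A] [CStarRing A]
    [NormedAlgebra ℂ A] [CompleteSpace A] [StarModule ℂ A]
    (L : ℕ) [NeZero L] (hL : 4 ≤ L)
    (a : (ZMod L × ZMod L) × Bool → A)
    (hcar1 : ∀ i j, a i * a j + a j * a i = 0)
    (hcar2 : ∀ i j, a i * star (a j) + star (a j) * a i =
      if i = j then 1 else 0)
    (u τ : ℝ) (hu : 0 ≤ u) (hτ : 0 < τ)
    (R : Matrix (ZMod L × ZMod L) (ZMod L × ZMod L) ℂ)
    (hRdef : ∀ v w, R v w =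
      if (v.1 = w.1 ∧ (v.2 = w.2 + 1 ∨ v.2 = w.2 - 1)) ∨
          (v.2 = w.2 ∧ (v.1 = w.1 + 1 ∨ v.1 = w.1 - 1)) then (τ : ℂ) else 0)
    (z : ZMod L × ZMod L → Bool → A)
    (hz : ∀ v σ, z v σ = 2 • (star (a (v, σ)) * a (v, σ)) - 1)
    (HI Hh : A)
    (hHI : HI = ((u : ℂ) / 4) • ∑ v, z v true * z v false)
    (hHh : Hh = ∑ p ∈ Finset.univ.offDiag,
      ∑ σ, R p.1 p.2 • (star (a (p.1, σ)) * a (p.2, σ))) :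
    ‖(HI * Hh - Hh * HI) * Hh - Hh * (HI * Hh - Hh * HI)‖
      ≤ u * τ ^ 2 * (L : ℝ) ^ 2 * (2 * Real.sqrt 5 + 16) := by
  have : Fact (1 < L) := ⟨by omega⟩
  have hR : ∀ v w, R v w = (squareHopping τ v w : ℝ) := by
    intro v w
    rw [hRdef, squareHopping]
    split_ifs <;> simp
  have hH : Hh = quadraticHamiltonian a (spinHopping L τ) := by
    rw [hHh, Finset.sum_subset (Finset.subset_univ Finset.univ.offDiag)]
    · simp only [quadraticHamiltonian,
        Fintype.sum_prod_type (α₁ := ZMod L × ZMod L) (α₂ := ZMod L × ZMod L),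
        Fintype.sum_prod_type (α₁ := ZMod L × ZMod L) (α₂ := Bool)]
      refine Finset.sum_congr rfl fun v _ => ?_
      rw [Finset.sum_comm]
      refine Finset.sum_congr rfl fun σ _ => Finset.sum_congr rfl fun w _ => ?_
      simp [spinHopping, hR, ite_smul]
    · rintro ⟨v, w⟩ _ hp
      obtain rfl : v = w := by simpa using hp
      simp [hR, squareHopping_self]
  have hτ0 := hτ.le
  have hbound : ∀ v σ, ‖z v σ‖ ≤ 1 ∧ ‖z v σ * Hh - Hh * z v σ‖ ≤ 4 * τ ∧
      ‖(z v σ * Hh - Hh * z v σ) * Hh - Hh * (z v σ * Hh - Hh * z v σ)‖ ≤ 24 * τ ^ 2 := by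
    intro v σ
    refine norm_commutators_le hcar1 hcar2 (isSymm_spinHopping τ) (v, σ) ?_ hτ0 ?_ ?_ hH (hz v σ)
    · simp [spinHopping, squareHopping_self]
    · exact (dotProduct_self_le (spinHopping_nonneg hτ0 _) (spinHopping_le hτ0 _) hτ0
        (sum_spinHopping_le hτ0 _)).trans_eq (by ring)
    · exact (mul_self_row_dotProduct_le (spinHopping_nonneg hτ0) (spinHopping_le hτ0) hτ0
        (by positivity) (sum_spinHopping_le hτ0) _).trans_eq (by ring)
  have hexp : (HI * Hh - Hh * HI) * Hh - Hh * (HI * Hh - Hh * HI) =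
      ((u : ℂ) / 4) • ∑ v, ((z v true * z v false * Hh - Hh * (z v true * z v false)) * Hh
        - Hh * (z v true * z v false * Hh - Hh * (z v true * z v false))) := by
    simp only [hHI, smul_mul_assoc, mul_smul_comm, ← smul_sub]
    simp only [sub_mul, mul_sub, Finset.sum_sub_distrib, Finset.sum_mul, Finset.mul_sum]
  have hsum : ‖∑ v, ((z v true * z v false * Hh - Hh * (z v true * z v false)) * Hh
        - Hh * (z v true * z v false * Hh - Hh * (z v true * z v false)))‖ ≤
      (L : ℝ) ^ 2 * (2 * (24 * τ ^ 2) + 2 * (4 * τ) ^ 2) := by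
    refine (norm_sum_le_of_le _ fun v _ =>
      norm_double_commutator_mul_le (hbound v true) (hbound v false)).trans_eq ?_
    simp [ZMod.card]
    ring
  have hu4 : ‖(u : ℂ) / 4‖ = u / 4 := by simp [abs_of_nonneg hu]
  have h5 : 2 ≤ Real.sqrt 5 := Real.le_sqrt_of_sq_le (by norm_num)
  rw [hexp, norm_smul, hu4]
  calc u / 4 * _ ≤ u / 4 * ((L : ℝ) ^ 2 * (2 * (24 * τ ^ 2) + 2 * (4 * τ) ^ 2)) := by gcongr
    _ = u * τ ^ 2 * (L : ℝ) ^ 2 * 20 := by ring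
    _ ≤ u * τ ^ 2 * (L : ℝ) ^ 2 * (2 * Real.sqrt 5 + 16) := by gcongr; linarith
end
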